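/- arXiv:2007.15370 — 2 statements merged into one kernel-verified Lean document; each statement's English description precedes it below -/
import Mathlib

section
/- Let A be a unital C*-algebra, let a ∈ A be a nonnegative element (selfadjoint with spectrum contained in [0,∞)), let b ∈ A, and let β ∈ (0,1). Then the A-valued function s ↦ s^β • ((a + s·1)⁻¹ · (a·b − b·a) · (a + s·1)⁻¹) is Bochner integrable on (0,∞), and a^β·b − b·a^β = (sin(πβ)/π) • ∫₀^∞ s^β • ((a + s·1)⁻¹ · (a·b − b·a) · (a + s·1)⁻¹) ds. -/
open MeasureTheory Real
open scoped NNReal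

lemma crc_beta_const {p : ℝ} (hp : p ∈ Set.Ioo (0:ℝ) 1) :
    ∫ t in Set.Ioi (0:ℝ), rpowIntegrand₀₁ p t 1 = π / Real.sin (π * p) := by
  have h1 : ProbabilityTheory.beta p (1 - p) = π / Real.sin (π * p) := by
    rw [ProbabilityTheory.beta, Real.Gamma_mul_Gamma_one_sub]; simp
  rw [← h1, ProbabilityTheory.beta_eq_betaIntegralReal p (1-p) hp.1 (by linarith [hp.2]),
    Complex.betaIntegral, intervalIntegral.integral_of_le (by norm_num)]
  have h2 : ∫ x : ℝ in Set.Ioc 0 1, (x:ℂ) ^ ((p:ℂ) - 1) * (1 - (x:ℂ)) ^ (((1 - p : ℝ) : ℂ) - 1)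
      = ((∫ x in Set.Ioo (0:ℝ) 1, x ^ (p - 1) * (1 - x) ^ (-p) : ℝ) : ℂ) := by
    rw [← integral_complex_ofReal, ← integral_Ioc_eq_integral_Ioo]
    refine setIntegral_congr_fun measurableSet_Ioc fun x hx => ?_
    rw [Complex.ofReal_mul, Complex.ofReal_cpow hx.1.le, Complex.ofReal_cpow (by linarith [hx.2])]
    push_cast
    congr 2
    ring
  rw [h2, Complex.ofReal_re]
  have him : (fun t : ℝ => 1 - (1 + t)⁻¹) '' Set.Ioi 0 = Set.Ioo 0 1 := by
    ext x
    simp only [Set.mem_image, Set.mem_Ioi, Set.mem_Ioo]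
    constructor
    · rintro ⟨t, ht, rfl⟩
      have h3 : (1 + t)⁻¹ < 1 := inv_lt_one_of_one_lt₀ (by linarith)
      have h4 : 0 < (1 + t)⁻¹ := by positivity
      constructor <;> linarith
    · rintro ⟨h3, h4⟩
      refine ⟨(1 - x)⁻¹ - 1, ?_, by simp⟩
      have := one_lt_inv₀ (a := 1 - x) (by linarith)
      linarith [this.2 (by linarith)]
  rw [← him, integral_image_eq_integral_abs_deriv_smul (f' := fun t => ((1 + t)^2)⁻¹)
    measurableSet_Ioi]
  · refine setIntegral_congr_fun measurableSet_Ioi fun t ht => ?_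
    have ht : 0 < t := ht
    have h5 : (0:ℝ) < 1 + t := by positivity
    rw [rpowIntegrand₀₁_eq_pow_div hp ht.le zero_le_one]
    have h6 : 1 - (1 + t)⁻¹ = t / (1 + t) := by field_simp; ring
    rw [h6, Real.div_rpow ht.le h5.le, ← h6, sub_sub_cancel, Real.inv_rpow h5.le,
      Real.rpow_neg h5.le, inv_inv, abs_of_pos (by positivity), Real.rpow_sub_one h5.ne', smul_eq_mul]
    have : (1 + t) ^ p ≠ 0 := by positivity
    rw [add_comm t 1]
    field_simp
  · intro t ht
    have ht : 0 < t := ht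
    have h5 : 1 + t ≠ 0 := by positivity
    have := (((hasDerivAt_id t).const_add 1).inv h5).const_sub 1
    refine (this.congr_deriv ?_).hasDerivWithinAt
    simp [neg_div]
  · intro x hx y hy h
    simpa using h

lemma crc_cfc {A : Type*} [CStarAlgebra A] [PartialOrder A] [StarOrderedRing A]
    (a : A) (ha : 0 ≤ a) {p : ℝ} (hp : p ∈ Set.Ioo (0:ℝ) 1) :
    IntegrableOn (fun t => cfc (rpowIntegrand₀₁ p t) a) (Set.Ioi 0) ∧
    a ^ p = (Real.sin (π * p) / π) • ∫ t in Set.Ioi (0:ℝ), cfc (rpowIntegrand₀₁ p t) a := by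
  obtain ⟨M, hM⟩ := (ContinuousFunctionalCalculus.isCompact_spectrum (R := ℝ) a).bddAbove
  have hM0 : 0 ≤ max M 0 := le_max_right _ _
  have hsp : spectrum ℝ a ⊆ Set.Ici 0 := fun x hx => spectrum_nonneg_of_nonneg ha hx
  let bound (t : ℝ) := rpowIntegrand₀₁ p t (max M 0)
  have hf : ContinuousOn (Function.uncurry (rpowIntegrand₀₁ p))
      (Set.Ioi (0 : ℝ) ×ˢ spectrum ℝ a) :=
    continuousOn_rpowIntegrand₀₁_uncurry hp _ hsp
  have hbound : ∀ᵐ t ∂volume.restrict (Set.Ioi 0), ∀ z ∈ spectrum ℝ a,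
      ‖rpowIntegrand₀₁ p t z‖ ≤ bound t := by
    filter_upwards [ae_restrict_mem measurableSet_Ioi] with t ht z hz
    rw [Real.norm_of_nonneg (rpowIntegrand₀₁_nonneg hp.1 (le_of_lt ht) (hsp hz))]
    exact rpowIntegrand₀₁_monotoneOn hp (le_of_lt ht) (hsp hz) hM0 ((hM hz).trans (le_max_left _ _))
  have hfin : HasFiniteIntegral bound (volume.restrict (Set.Ioi 0)) :=
    (integrableOn_rpowIntegrand₀₁_Ioi hp hM0).2
  refine ⟨integrableOn_cfc measurableSet_Ioi _ bound a hf hbound hfin ha.isSelfAdjoint, ?_⟩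
  rw [← cfc_setIntegral measurableSet_Ioi _ bound a hf hbound hfin ha.isSelfAdjoint,
    CFC.rpow_eq_cfc_real ha]
  have h1 : cfc (fun x : ℝ => x ^ p) a = cfc (fun x : ℝ => (π / Real.sin (π * p))⁻¹ •
      ∫ t in Set.Ioi (0:ℝ), rpowIntegrand₀₁ p t x) a := by
    refine cfc_congr fun x hx => ?_
    rw [← crc_beta_const hp]
    exact rpow_eq_const_mul_integral hp (hsp hx)
  have h2 : Set.EqOn (fun x : ℝ => ∫ t in Set.Ioi (0:ℝ), rpowIntegrand₀₁ p t x)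
     (fun x => x ^ p * (∫ t in Set.Ioi 0, rpowIntegrand₀₁ p t 1)) (spectrum ℝ a) :=
    fun x hx => integral_rpowIntegrand₀₁_eq_rpow_mul_const hp (hsp hx)
  have h3 : ContinuousOn (fun x : ℝ => ∫ t in Set.Ioi (0:ℝ), rpowIntegrand₀₁ p t x)
      (spectrum ℝ a) := by
    refine ContinuousOn.congr ?_ h2
    exact ((Real.continuous_rpow_const hp.1.le).mul continuous_const).continuousOn
  rw [h1, inv_div, cfc_smul _ _ _ h3]

lemma crc_res {A : Type*} [CStarAlgebra A]
    (a : A) (ha : IsSelfAdjoint a) (ha' : spectrum ℝ a ⊆ Set.Ici (0 : ℝ))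
    {β : ℝ} (hβ : β ∈ Set.Ioo (0 : ℝ) 1) {t : ℝ} (ht : 0 < t) :
    IsUnit (a + t • (1 : A)) ∧ cfc (rpowIntegrand₀₁ β t) a =
        algebraMap ℝ A (t ^ (β - 1)) - t ^ β • Ring.inverse (a + t • (1 : A)) := by
  have hne : ∀ r ∈ spectrum ℝ a, t + r ≠ 0 := fun r hr => by
    have : 0 ≤ r := ha' hr
    positivity
  have hc : ContinuousOn (fun z : ℝ => t + z) (spectrum ℝ a) := by fun_prop
  have hg : ContinuousOn (fun z : ℝ => (t + z)⁻¹) (spectrum ℝ a) := hc.inv₀ hne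
  have hg' : ContinuousOn (fun z : ℝ => t ^ β * (t + z)⁻¹) (spectrum ℝ a) :=
    continuousOn_const.mul hg
  have h2 : cfc (fun z : ℝ => t + z) a = a + t • (1 : A) := by
    rw [cfc_const_add t (fun z : ℝ => z) a continuousOn_id ha, cfc_id' ℝ a ha,
      Algebra.algebraMap_eq_smul_one t, add_comm]
  constructor
  · rw [← h2]
    exact (isUnit_cfc_iff _ a hc ha).2 hne
  · rw [rpowIntegrand₀₁_eq_sub hβ.2.ne ht,
      cfc_sub (fun _ : ℝ => t ^ (β - 1)) (fun z : ℝ => t ^ β * (t + z)⁻¹) a continuousOn_const hg',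
      cfc_const _ a ha, cfc_const_mul _ _ a hg, cfc_inv _ a hne hc ha, h2]

theorem commutator_rpow_cstar {A : Type*} [CStarAlgebra A] [PartialOrder A] [StarOrderedRing A]
    (a : A) (ha : IsSelfAdjoint a) (ha' : spectrum ℝ a ⊆ Set.Ici (0 : ℝ))
    (b : A) (β : ℝ) (hβ : β ∈ Set.Ioo (0 : ℝ) 1) :
    MeasureTheory.IntegrableOn
      (fun s : ℝ => s ^ β •
        (Ring.inverse (a + s • (1 : A)) * (a * b - b * a) * Ring.inverse (a + s • (1 : A))))
      (Set.Ioi 0) ∧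
    a ^ β * b - b * a ^ β = (Real.sin (Real.pi * β) / Real.pi) •
      ∫ s in Set.Ioi (0 : ℝ), s ^ β •
        (Ring.inverse (a + s • (1 : A)) * (a * b - b * a) * Ring.inverse (a + s • (1 : A))) := by
  have h0 : 0 ≤ a := by
    rw [nonneg_iff_isSelfAdjoint_and_quasispectrumRestricts, quasispectrumRestricts_iff_spectrumRestricts, SpectrumRestricts.nnreal_iff]
    exact ⟨ha, fun x hx => ha' hx⟩
  obtain ⟨hint, heq⟩ := crc_cfc a h0 hβ
  have key : Set.EqOn (fun t => cfc (rpowIntegrand₀₁ β t) a * b - b * cfc (rpowIntegrand₀₁ β t) a)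
      (fun s : ℝ => s ^ β •
        (Ring.inverse (a + s • (1 : A)) * (a * b - b * a) * Ring.inverse (a + s • (1 : A))))
      (Set.Ioi 0) := by
    intro t ht
    have ht : 0 < t := ht
    obtain ⟨hu, h1⟩ := crc_res a ha ha' hβ ht
    simp only [h1]
    generalize hR : Ring.inverse (a + t • (1 : A)) = R
    have e1 : R * (a + t • 1) = 1 := hR ▸ Ring.inverse_mul_cancel _ hu
    have e2 : (a + t • 1) * R = 1 := hR ▸ Ring.mul_inverse_cancel _ hu
    have e3 : R * (a * b - b * a) * R = b * R - R * b := by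
      have : a * b - b * a = (a + t • 1) * b - b * (a + t • 1) := by
        simp [add_mul, mul_add]
      rw [this, mul_sub, sub_mul, ← mul_assoc, e1, one_mul, mul_assoc, mul_assoc, e2, mul_one]
    rw [e3, sub_mul, mul_sub, Algebra.commutes, smul_sub, smul_mul_assoc, mul_smul_comm]
    abel
  have i1 := hint.mul_const b
  have i2 := hint.const_mul b
  refine ⟨IntegrableOn.congr_fun (Integrable.sub i1 i2) key measurableSet_Ioi, ?_⟩
  rw [← setIntegral_congr_fun measurableSet_Ioi key, integral_sub i1 i2, heq, smul_sub,
    integral_mul_const_of_integrable hint, integral_const_mul_of_integrable hint,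
    smul_mul_assoc, mul_smul_comm]
end

section
/- Let w₀ ∈ ℝ² with w₀ ≠ 0, let c ∈ ℝ, and let f : ℝ² → ℂ be differentiable and satisfy c·f(x) + Df(x)[w₀] = 0 for every x ∈ ℝ², where Df(x) is the Fréchet derivative of f at x. If f(x) → 0 as ‖x‖ → ∞ (i.e., f tends to 0 along the cocompact filter on ℝ²), then f is identically zero. -/
open Filter

/-- **Rigidity for the first-order equation `c·f + ∂_{w₀} f = 0` with decay.**
If `w₀ ≠ 0`, `f : ℝ² → ℂ` is differentiable, `c·f(x) + Df(x)[w₀] = 0` for all `x`, and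
`f → 0` along the cocompact filter (i.e. as `‖x‖ → ∞`), then `f ≡ 0`. -/
theorem rigidity_first_order_decay
    (w₀ : EuclideanSpace ℝ (Fin 2)) (hw₀ : w₀ ≠ 0) (c : ℝ)
    (f : EuclideanSpace ℝ (Fin 2) → ℂ) (hf : Differentiable ℝ f)
    (heq : ∀ x, (c : ℂ) * f x + fderiv ℝ f x w₀ = 0)
    (hdecay : Filter.Tendsto f (Filter.cocompact (EuclideanSpace ℝ (Fin 2))) (nhds 0)) :
    ∀ x, f x = 0 := by
  intro x
  have hd : ∀ t : ℝ, HasDerivAt (fun t : ℝ => f (x + t • w₀)) (fderiv ℝ f (x + t • w₀) w₀) t := by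
    intro t
    have h1 : HasDerivAt (fun t : ℝ => x + t • w₀) w₀ t := by
      simpa using ((hasDerivAt_id t).smul_const w₀).const_add x
    exact (hf (x + t • w₀)).hasFDerivAt.comp_hasDerivAt t h1
  have he : ∀ t : ℝ, HasDerivAt (fun t : ℝ => Complex.exp ((c : ℂ) * (t : ℂ)))
      (Complex.exp ((c : ℂ) * (t : ℂ)) * (c : ℂ)) t := by
    intro t
    have h1 : HasDerivAt (fun t : ℝ => (c : ℂ) * (t : ℂ)) (c : ℂ) t := by
      simpa using (Complex.ofRealCLM.hasDerivAt (x := t)).const_mul (c : ℂ)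
    exact h1.cexp
  have hh : ∀ t : ℝ, HasDerivAt
      (fun t : ℝ => Complex.exp ((c : ℂ) * (t : ℂ)) * f (x + t • w₀)) 0 t := by
    intro t
    refine ((he t).mul (hd t)).congr_deriv ?_
    linear_combination Complex.exp ((c : ℂ) * (t : ℂ)) * heq (x + t • w₀)
  have hc : ∀ t : ℝ, Complex.exp ((c : ℂ) * (t : ℂ)) * f (x + t • w₀) = f x := by
    intro t
    have := is_const_of_deriv_eq_zero (fun t => (hh t).differentiableAt)
      (fun t => (hh t).deriv) t 0
    simpa using this
  have hsq : ∀ t : ℝ, f (x + t • w₀) * f (x + (-t) • w₀) = f x * f x := by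
    intro t
    have h1 := hc t
    have h2 := hc (-t)
    have h3 : Complex.exp ((c : ℂ) * (t : ℂ)) * Complex.exp ((c : ℂ) * ((-t : ℝ) : ℂ)) = 1 := by
      rw [← Complex.exp_add]; simp
    calc _ = (Complex.exp ((c : ℂ) * (t : ℂ)) * Complex.exp ((c : ℂ) * ((-t : ℝ) : ℂ))) *
          (f (x + t • w₀) * f (x + (-t) • w₀)) := by rw [h3, one_mul]
      _ = (Complex.exp ((c : ℂ) * (t : ℂ)) * f (x + t • w₀)) *
          (Complex.exp ((c : ℂ) * ((-t : ℝ) : ℂ)) * f (x + (-t) • w₀)) := by ring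
      _ = _ := by rw [h1, h2]
  have key : ∀ v : EuclideanSpace ℝ (Fin 2), v ≠ 0 →
      Tendsto (fun t : ℝ => f (x + t • v)) atTop (nhds 0) := by
    intro v hv
    refine hdecay.comp ?_
    rw [← Metric.cobounded_eq_cocompact, ← tendsto_norm_atTop_iff_cobounded]
    have h1 : Tendsto (fun t : ℝ => t * ‖v‖ - ‖x‖) atTop atTop :=
      tendsto_atTop_add_const_right _ _ (tendsto_id.atTop_mul_const (norm_pos_iff.mpr hv))
    refine tendsto_atTop_mono (fun t => ?_) h1
    have h2 : ‖t • v‖ ≤ ‖x + t • v‖ + ‖x‖ := by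
      simpa using norm_sub_le (x + t • v) x
    rw [norm_smul, Real.norm_eq_abs] at h2
    nlinarith [le_abs_self t, norm_nonneg v]
  have hlim := (key w₀ hw₀).mul (key (-w₀) (neg_ne_zero.mpr hw₀))
  have hlim2 : Tendsto (fun _ : ℝ => f x * f x) atTop (nhds (0 * 0)) := by
    refine hlim.congr (fun t => ?_)
    rw [← hsq t, neg_smul, smul_neg]
  have := tendsto_nhds_unique tendsto_const_nhds hlim2
  simpa using this
end
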